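/- Assume the non-resonant condition holds and β > 0. Let θ : Ω → Ω be the left shift, θ(ω)_t = ω_{t+1}. Then for every probability distribution ν on ℕ, the image measures ℙ_ν ∘ θ^{−t} converge to ℙ_{μ_Gibbs} in total variation: lim_{t→∞} sup_{O measurable} |ℙ_ν(θ^{−t}(O)) − ℙ_{μ_Gibbs}(O)| = 0. (Theorem 2.5 restricted to initial states diagonal in the Fock basis.) -/

import Mathlib

open MeasureTheory Filter Real
open scoped ENNReal

noncomputable def pMinus (β ε : ℝ) : ℝ := 1 / (1 + Real.exp (-(β * ε)))

noncomputable def pPlus (β ε : ℝ) : ℝ := Real.exp (-(β * ε)) / (1 + Real.exp (-(β * ε)))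

noncomputable def rabiAlpha (ξ η : ℝ) (k : ℕ) : ℝ :=
  if k = 0 then 0
  else Real.sin (Real.pi * Real.sqrt (ξ * k + η)) ^ 2 * (ξ * k) / (ξ * k + η)

def IsRabiResonance (ξ η : ℝ) (n : ℕ) : Prop :=
  1 ≤ n ∧ ∃ j : ℕ, ξ * n + η = (j : ℝ) ^ 2

def NonResonant (ξ η : ℝ) : Prop := ∀ n : ℕ, ¬ IsRabiResonance ξ η n

noncomputable def bdKernel (β ε ξ η : ℝ) (k l : ℕ) : ℝ :=
  if l = k + 1 then pPlus β ε * rabiAlpha ξ η (k + 1)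
  else if l + 1 = k then pMinus β ε * rabiAlpha ξ η k
  else if l = k then 1 - pMinus β ε * rabiAlpha ξ η k - pPlus β ε * rabiAlpha ξ η (k + 1)
  else 0

noncomputable def muGibbs (β ε : ℝ) (k : ℕ) : ℝ :=
  (1 - Real.exp (-(β * ε))) * Real.exp (-(k : ℝ) * (β * ε))

noncomputable def bdKernelPow (β ε ξ η : ℝ) : ℕ → ℕ → ℕ → ℝ
  | 0, k, l => if k = l then 1 else 0
  | t + 1, k, l => ∑' j : ℕ, bdKernelPow β ε ξ η t k j * bdKernel β ε ξ η j l

inductive Outcome : Type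
  | mm | mp | pm | pp
  deriving DecidableEq

instance : MeasurableSpace Outcome := ⊤

noncomputable def stepWeight (β ε ξ η : ℝ) (k : ℕ) : Outcome → ℝ
  | .mm => pMinus β ε * (1 - rabiAlpha ξ η k)
  | .mp => pMinus β ε * rabiAlpha ξ η k
  | .pm => pPlus β ε * rabiAlpha ξ η (k + 1)
  | .pp => pPlus β ε * (1 - rabiAlpha ξ η (k + 1))

def stepSucc (k : ℕ) : Outcome → ℕ
  | .mm => k
  | .mp => k - 1
  | .pm => k + 1
  | .pp => k

noncomputable def wordWeight (β ε ξ η : ℝ) : ℕ → List Outcome → ℝ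
  | _, [] => 1
  | k, a :: w => stepWeight β ε ξ η k a * wordWeight β ε ξ η (stepSucc k a) w

def cylinder (w : List Outcome) : Set (ℕ → Outcome) :=
  {ω | ∀ i : Fin w.length, ω i = w.get i}

def outDelta : Outcome → ℤ
  | .mp => -1
  | .pm => 1
  | _ => 0

def sShift (ω : ℕ → Outcome) (t : ℕ) : ℤ := ∑ u ∈ Finset.range t, outDelta (ω u)

noncomputable def tauExt (k : ℕ) (ω : ℕ → Outcome) : ℕ∞ :=
  sInf ((fun t : ℕ => (t : ℕ∞)) '' {t : ℕ | 1 ≤ t ∧ (k : ℤ) + sShift ω t < 0})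

noncomputable def NFock (k : ℕ) (ω : ℕ → Outcome) (t : ℕ) : ℤ :=
  if (t : ℕ∞) < tauExt k ω then (k : ℤ) + sShift ω t else -1

noncomputable def firstReturn (k : ℕ) (ω : ℕ → Outcome) : ℕ∞ :=
  sInf ((fun t : ℕ => (t : ℕ∞)) '' {t : ℕ | 1 ≤ t ∧ NFock k ω t = (k : ℤ)})

open Topology

namespace BD

/-- one-step operator -/
noncomputable def Q (a b : ℕ → ℝ) (f : ℕ → ℝ) (k : ℕ) : ℝ :=
  a k * f (k - 1) + b k * f (k + 1) + (1 - a k - b k) * f k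

structure Good (a b m : ℕ → ℝ) : Prop where
  a0 : a 0 = 0
  apos : ∀ k, 0 < a (k + 1)
  bpos : ∀ k, 0 < b k
  le1 : ∀ k, a k + b k ≤ 1
  b0 : b 0 < 1
  mpos : ∀ k, 0 < m k
  bal : ∀ k, m k * b k = m (k + 1) * a (k + 1)
  hm : HasSum m 1

variable {a b m : ℕ → ℝ}

lemma Good.ann (h : Good a b m) (k : ℕ) : 0 ≤ a k := by
  cases k with
  | zero => rw [h.a0]
  | succ n => exact (h.apos n).le

lemma Q_one (k : ℕ) : Q a b (fun _ => 1) k = 1 := by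
  unfold Q; ring

lemma Good.Q_mem (h : Good a b m) {f : ℕ → ℝ} (hf : ∀ k, 0 ≤ f k ∧ f k ≤ 1) (k : ℕ) :
    0 ≤ Q a b f k ∧ Q a b f k ≤ 1 := by
  have h1 := h.ann k
  have h2 := (h.bpos k).le
  have h3 : 0 ≤ 1 - a k - b k := by linarith [h.le1 k]
  unfold Q
  constructor
  · have := mul_nonneg h1 (hf (k-1)).1
    have := mul_nonneg h2 (hf (k+1)).1
    have := mul_nonneg h3 (hf k).1
    linarith
  · have := mul_nonneg h1 (sub_nonneg.2 (hf (k-1)).2)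
    have := mul_nonneg h2 (sub_nonneg.2 (hf (k+1)).2)
    have := mul_nonneg h3 (sub_nonneg.2 (hf k).2)
    nlinarith

lemma Good.iter_mem (h : Good a b m) {f : ℕ → ℝ} (hf : ∀ k, 0 ≤ f k ∧ f k ≤ 1) (t : ℕ) :
    ∀ k, 0 ≤ (Q a b)^[t] f k ∧ (Q a b)^[t] f k ≤ 1 := by
  induction t with
  | zero => simpa using hf
  | succ n ih =>
    intro k
    rw [Function.iterate_succ_apply']
    exact h.Q_mem ih k

lemma Good.summ (h : Good a b m) {f : ℕ → ℝ} (C : ℝ) (hf : ∀ k, |f k| ≤ C) :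
    Summable fun k => m k * f k := by
  refine Summable.of_norm_bounded (h.hm.summable.mul_right C) fun k => ?_
  rw [Real.norm_eq_abs, abs_mul, abs_of_pos (h.mpos k)]
  exact mul_le_mul_of_nonneg_left (hf k) (h.mpos k).le

lemma abs_le_of_mem {x : ℝ} (h : 0 ≤ x ∧ x ≤ 1) : |x| ≤ 1 := by
  rw [abs_of_nonneg h.1]; exact h.2

lemma mul_mem {x y : ℝ} (h : 0 ≤ x ∧ x ≤ 1) (h' : 0 ≤ y ∧ y ≤ 1) : 0 ≤ x * y ∧ x * y ≤ 1 :=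
  ⟨mul_nonneg h.1 h'.1, mul_le_one₀ h.2 h'.1 h'.2⟩

lemma Good.symm (h : Good a b m) {f g : ℕ → ℝ} (hf : ∀ k, 0 ≤ f k ∧ f k ≤ 1)
    (hg : ∀ k, 0 ≤ g k ∧ g k ≤ 1) :
    ∑' k, m k * (Q a b f k * g k) = ∑' k, m k * (f k * Q a b g k) := by
  have s1 : Summable fun k => m k * (Q a b f k * g k) :=
    h.summ 1 fun k => abs_le_of_mem (mul_mem (h.Q_mem hf k) (hg k))
  have s2 : Summable fun k => m k * (f k * Q a b g k) :=
    h.summ 1 fun k => abs_le_of_mem (mul_mem (hf k) (h.Q_mem hg k))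
  let A : ℕ → ℝ := fun k => m k * (a k * (f (k - 1) * g k) - a k * (f k * g (k - 1)))
  have ha : ∀ k, 0 ≤ a k ∧ a k ≤ 1 := fun k => ⟨h.ann k, by linarith [h.le1 k, h.bpos k]⟩
  have sA : Summable A := by
    refine h.summ 2 fun k => ?_
    have e1 := mul_mem (ha k) (mul_mem (hf (k-1)) (hg k))
    have e2 := mul_mem (ha k) (mul_mem (hf k) (hg (k-1)))
    rw [abs_le]; constructor <;> linarith
  have key : ∀ k, m k * (Q a b f k * g k) - m k * (f k * Q a b g k) = A k - A (k+1) := by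
    intro k
    have := h.bal k
    simp only [A, Q, Nat.add_sub_cancel]
    linear_combination (f (k+1) * g k - f k * g (k+1)) * this
  have hA := sA.tsum_eq_zero_add
  have hA0 : A 0 = 0 := by simp [A, h.a0]
  have sA' : Summable fun k => A (k+1) := (summable_nat_add_iff 1).2 sA
  have : ∑' k, (m k * (Q a b f k * g k) - m k * (f k * Q a b g k)) = 0 := by
    simp_rw [key]
    rw [sA.tsum_sub sA', hA, hA0]; ring
  rw [s1.tsum_sub s2] at this
  linarith

lemma Good.symm_iter (h : Good a b m) (t : ℕ) : ∀ {f g : ℕ → ℝ} (_ : ∀ k, 0 ≤ f k ∧ f k ≤ 1)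
    (_ : ∀ k, 0 ≤ g k ∧ g k ≤ 1),
    ∑' k, m k * ((Q a b)^[t] f k * g k) = ∑' k, m k * (f k * (Q a b)^[t] g k) := by
  induction t with
  | zero => intros; rfl
  | succ n ih =>
    intro f g hf hg
    rw [Function.iterate_succ_apply, ih (h.Q_mem hf) hg, Function.iterate_succ_apply',
      h.symm hf (h.iter_mem hg n)]

lemma Q_one' : Q a b (fun _ => 1) = fun _ => 1 := by
  funext k; unfold Q; ring

lemma iter_one (t : ℕ) : (Q a b)^[t] (fun _ => 1) = fun _ => 1 := by
  induction t with
  | zero => rfl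
  | succ n ih => rw [Function.iterate_succ_apply, Q_one', ih]

lemma var_eq (f : ℕ → ℝ) (k : ℕ) :
    Q a b (fun j => f j * f j) k - Q a b f k * Q a b f k =
      a k * b k * (f (k+1) - f (k-1))^2 + a k * (1 - a k - b k) * (f k - f (k-1))^2
      + b k * (1 - a k - b k) * (f (k+1) - f k)^2 := by
  unfold Q; ring

lemma Good.energy (h : Good a b m) {f : ℕ → ℝ} (hf : ∀ k, 0 ≤ f k ∧ f k ≤ 1) (x : ℕ) :
    m x * (Q a b (fun j => f j * f j) x - Q a b f x * Q a b f x) ≤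
      ∑' k, m k * (f k * f k) - ∑' k, m k * (Q a b f k * Q a b f k) := by
  have hff : ∀ k, 0 ≤ f k * f k ∧ f k * f k ≤ 1 := fun k => mul_mem (hf k) (hf k)
  have s1 : Summable fun k => m k * Q a b (fun j => f j * f j) k :=
    h.summ 1 fun k => abs_le_of_mem (h.Q_mem hff k)
  have s2 : Summable fun k => m k * (Q a b f k * Q a b f k) :=
    h.summ 1 fun k => abs_le_of_mem (mul_mem (h.Q_mem hf k) (h.Q_mem hf k))
  have e := h.symm hff (g := fun _ => 1) (fun k => ⟨zero_le_one, le_rfl⟩)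
  rw [Q_one'] at e
  simp only [mul_one] at e
  rw [← e, ← s1.tsum_sub s2]
  simp_rw [← mul_sub]
  have hs := s1.sub s2
  simp_rw [← mul_sub] at hs
  refine hs.le_tsum x fun k _ => mul_nonneg (h.mpos k).le ?_
  rw [var_eq]
  have h1 := h.ann k
  have h2 := (h.bpos k).le
  have h3 : 0 ≤ 1 - a k - b k := by linarith [h.le1 k]
  positivity

lemma Good.var_tendsto (h : Good a b m) {f : ℕ → ℝ} (hf : ∀ k, 0 ≤ f k ∧ f k ≤ 1) (x : ℕ) :
    Tendsto (fun t => Q a b (fun j => (Q a b)^[t] f j * (Q a b)^[t] f j) x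
      - Q a b ((Q a b)^[t] f) x * Q a b ((Q a b)^[t] f) x) atTop (𝓝 0) := by
  set E : ℕ → ℝ := fun t => ∑' k, m k * ((Q a b)^[t] f k * (Q a b)^[t] f k) with hE
  have vnn : ∀ t, 0 ≤ Q a b (fun j => (Q a b)^[t] f j * (Q a b)^[t] f j) x
      - Q a b ((Q a b)^[t] f) x * Q a b ((Q a b)^[t] f) x := by
    intro t
    rw [var_eq]
    have h1 := h.ann x
    have h2 := (h.bpos x).le
    have h3 : 0 ≤ 1 - a x - b x := by linarith [h.le1 x]
    positivity
  have step : ∀ t, m x * (Q a b (fun j => (Q a b)^[t] f j * (Q a b)^[t] f j) x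
      - Q a b ((Q a b)^[t] f) x * Q a b ((Q a b)^[t] f) x) ≤ E t - E (t+1) := by
    intro t
    have := h.energy (h.iter_mem hf t) x
    simpa only [hE, Function.iterate_succ_apply'] using this
  have anti : Antitone E := antitone_nat_of_succ_le fun t => by
    have := step t
    have := mul_nonneg (h.mpos x).le (vnn t)
    linarith
  have bdd : BddBelow (Set.range E) := ⟨0, by
    rintro _ ⟨t, rfl⟩
    exact tsum_nonneg fun k => mul_nonneg (h.mpos k).le (mul_self_nonneg _)⟩
  have lim := tendsto_atTop_ciInf anti bdd
  have lim2 : Tendsto (fun t => (E t - E (t+1)) / m x) atTop (𝓝 0) := by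
    have := (lim.sub ((tendsto_add_atTop_iff_nat 1).2 lim)).div_const (m x)
    simpa using this
  refine squeeze_zero vnn (fun t => ?_) lim2
  rw [le_div_iff₀ (h.mpos x), mul_comm]
  exact step t

lemma tendsto_of_sq {u : ℕ → ℝ} (v : ℕ → ℝ) {c : ℝ} (hc : 0 < c) (hv : Tendsto v atTop (𝓝 0))
    (hle : ∀ t, c * u t ^ 2 ≤ v t) : Tendsto u atTop (𝓝 0) := by
  have h2 : Tendsto (fun t => u t ^ 2) atTop (𝓝 0) := by
    refine squeeze_zero (fun t => sq_nonneg _) (fun t => ?_) (by simpa using hv.div_const c)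
    rw [le_div_iff₀ hc, mul_comm]; exact hle t
  have h3 := h2.sqrt
  simp only [Real.sqrt_sq_eq_abs, Real.sqrt_zero] at h3
  exact (tendsto_zero_iff_abs_tendsto_zero _).2 h3

lemma Good.diff_tendsto (h : Good a b m) {f : ℕ → ℝ} (hf : ∀ k, 0 ≤ f k ∧ f k ≤ 1) (x : ℕ) :
    Tendsto (fun t => (Q a b)^[t] f x - (Q a b)^[t] f 0) atTop (𝓝 0) := by
  induction x using Nat.strong_induction_on with
  | _ x ih =>
  match x with
  | 0 => simp
  | 1 =>
    refine tendsto_of_sq _ (mul_pos (h.bpos 0) (sub_pos.2 h.b0)) (h.var_tendsto hf 0) fun t => ?_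
    rw [var_eq, h.a0]
    simp
  | n + 2 =>
    have i := ih n (by omega)
    have : Tendsto (fun t => (Q a b)^[t] f (n+2) - (Q a b)^[t] f n) atTop (𝓝 0) := by
      refine tendsto_of_sq _ (mul_pos (h.apos n) (h.bpos (n+1))) (h.var_tendsto hf (n+1))
        fun t => ?_
      rw [var_eq]
      have h1 := h.ann (n+1)
      have h2 := (h.bpos (n+1)).le
      have h3 : 0 ≤ 1 - a (n+1) - b (n+1) := by linarith [h.le1 (n+1)]
      simp only [Nat.add_sub_cancel]
      have : 0 ≤ a (n+1) * (1 - a (n+1) - b (n+1)) * ((Q a b)^[t] f (n+1) - (Q a b)^[t] f n)^2 := by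
        positivity
      have : 0 ≤ b (n+1) * (1 - a (n+1) - b (n+1)) *
        ((Q a b)^[t] f (n+1+1) - (Q a b)^[t] f (n+1))^2 := by positivity
      have e : n + 1 + 1 = n + 2 := rfl
      rw [e] at *
      linarith
    simpa using this.add i

lemma Good.mean (h : Good a b m) {f : ℕ → ℝ} (hf : ∀ k, 0 ≤ f k ∧ f k ≤ 1) (t : ℕ) :
    ∑' k, m k * (Q a b)^[t] f k = ∑' k, m k * f k := by
  have := h.symm_iter t hf (g := fun _ => 1) (fun k => ⟨zero_le_one, le_rfl⟩)
  rw [iter_one] at this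
  simpa using this

lemma Good.conv (h : Good a b m) {f : ℕ → ℝ} (hf : ∀ k, 0 ≤ f k ∧ f k ≤ 1) (x : ℕ) :
    Tendsto (fun t => (Q a b)^[t] f x) atTop (𝓝 (∑' k, m k * f k)) := by
  have h1 : Tendsto (fun t => ∑' y, m y * ((Q a b)^[t] f x - (Q a b)^[t] f y)) atTop
      (𝓝 (∑' y : ℕ, (0:ℝ))) := by
    refine tendsto_tsum_of_dominated_convergence (bound := m) h.hm.summable ?_ ?_
    · intro y
      have := ((h.diff_tendsto hf x).sub (h.diff_tendsto hf y)).const_mul (m y)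
      simpa using this
    · refine Eventually.of_forall fun t y => ?_
      have e1 := h.iter_mem hf t x
      have e2 := h.iter_mem hf t y
      rw [Real.norm_eq_abs, abs_mul, abs_of_pos (h.mpos y)]
      refine mul_le_of_le_one_right (h.mpos y).le ?_
      rw [abs_le]; constructor <;> linarith
  rw [tsum_zero] at h1
  have h2 : ∀ t, ∑' y, m y * ((Q a b)^[t] f x - (Q a b)^[t] f y) =
      (Q a b)^[t] f x - ∑' k, m k * f k := by
    intro t
    simp_rw [mul_sub]
    rw [(h.hm.summable.mul_right _).tsum_sub (h.summ 1 fun k => abs_le_of_mem (h.iter_mem hf t k)),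
      h.mean hf, tsum_mul_right, h.hm.tsum_eq, one_mul]
  simp_rw [h2] at h1
  simpa using h1.add_const (∑' k, m k * f k)

/-- indicator of a point -/
noncomputable def ind (k : ℕ) : ℕ → ℝ := fun j => if j = k then 1 else 0

lemma ind_mem (k j : ℕ) : 0 ≤ ind k j ∧ ind k j ≤ 1 := by
  unfold ind; split_ifs <;> norm_num

/-- distance -/
noncomputable def D (a b m : ℕ → ℝ) (k t : ℕ) : ℝ :=
  ∑' x, m x * |(Q a b)^[t] (ind k) x / m k - 1|

lemma Good.bd (h : Good a b m) (k t x : ℕ) :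
    |(|(Q a b)^[t] (ind k) x / m k - 1|)| ≤ 1 / m k + 1 := by
  have e := h.iter_mem (ind_mem k) t x
  have hk := h.mpos k
  have : 0 ≤ (Q a b)^[t] (ind k) x / m k := div_nonneg e.1 hk.le
  have : (Q a b)^[t] (ind k) x / m k ≤ 1 / m k := by gcongr; exact e.2
  rw [abs_abs, abs_le]; constructor <;> linarith

lemma Good.D_tendsto (h : Good a b m) (k : ℕ) : Tendsto (D a b m k) atTop (𝓝 0) := by
  have h1 : Tendsto (D a b m k) atTop (𝓝 (∑' x : ℕ, (0:ℝ))) := by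
    refine tendsto_tsum_of_dominated_convergence (bound := fun x => m x * (1 / m k + 1))
      (h.hm.summable.mul_right _) ?_ ?_
    · intro x
      have c := h.conv (ind_mem k) x
      have e : ∑' j, m j * ind k j = m k := by
        rw [tsum_eq_single k (by intro j hj; simp [ind, hj])]; simp [ind]
      rw [e] at c
      have := (((c.div_const (m k)).sub_const 1).abs).const_mul (m x)
      rw [div_self (h.mpos k).ne'] at this
      simpa using this
    · refine Eventually.of_forall fun t x => ?_
      rw [Real.norm_eq_abs, abs_mul, abs_of_pos (h.mpos x)]
      exact mul_le_mul_of_nonneg_left (h.bd k t x) (h.mpos x).le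
  simpa using h1

lemma Good.bound (h : Good a b m) {F : ℕ → ℝ} (hF : ∀ k, 0 ≤ F k ∧ F k ≤ 1) (k t : ℕ) :
    |(Q a b)^[t] F k - ∑' x, m x * F x| ≤ D a b m k t := by
  have hk := h.mpos k
  have s := h.symm_iter t (ind_mem k) hF
  rw [tsum_eq_single (f := fun j => m j * (ind k j * (Q a b)^[t] F j)) k
    (by intro j hj; simp [ind, hj])] at s
  have s' : (Q a b)^[t] F k = ∑' x, m x * ((Q a b)^[t] (ind k) x / m k * F x) := by
    have : ∀ x, m x * ((Q a b)^[t] (ind k) x / m k * F x) =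
        (m x * ((Q a b)^[t] (ind k) x * F x)) / m k := fun x => by ring
    simp_rw [this]
    rw [tsum_div_const, s]
    simp [ind]
    field_simp
  have sm1 : Summable fun x => m x * ((Q a b)^[t] (ind k) x / m k * F x) := by
    have : ∀ x, m x * ((Q a b)^[t] (ind k) x / m k * F x) =
        (m x * ((Q a b)^[t] (ind k) x * F x)) / m k := fun x => by ring
    simp_rw [this]
    exact (h.summ 1 fun x => abs_le_of_mem (mul_mem (h.iter_mem (ind_mem k) t x) (hF x))).div_const _
  have sm2 : Summable fun x => m x * F x := h.summ 1 fun x => abs_le_of_mem (hF x)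
  rw [s', ← sm1.tsum_sub sm2]
  have sD := h.summ _ (h.bd k t)
  have hle : ∀ x, ‖m x * ((Q a b)^[t] (ind k) x / m k * F x) - m x * F x‖ ≤
      m x * |(Q a b)^[t] (ind k) x / m k - 1| := by
    intro x
    have : m x * ((Q a b)^[t] (ind k) x / m k * F x) - m x * F x =
      m x * (((Q a b)^[t] (ind k) x / m k - 1) * F x) := by ring
    rw [this, Real.norm_eq_abs, abs_mul, abs_mul, abs_of_pos (h.mpos x)]
    refine mul_le_mul_of_nonneg_left ?_ (h.mpos x).le
    exact mul_le_of_le_one_right (abs_nonneg _) (abs_le_of_mem (hF x))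
  exact tsum_of_norm_bounded sD.hasSum hle

lemma Good.bound1 (h : Good a b m) {F : ℕ → ℝ} (hF : ∀ k, 0 ≤ F k ∧ F k ≤ 1) (k t : ℕ) :
    |(Q a b)^[t] F k - ∑' x, m x * F x| ≤ 1 := by
  have e := h.iter_mem hF t k
  have sm2 : Summable fun x => m x * F x := h.summ 1 fun x => abs_le_of_mem (hF x)
  have e1 : 0 ≤ ∑' x, m x * F x := tsum_nonneg fun x => mul_nonneg (h.mpos x).le (hF x).1
  have e2 : ∑' x, m x * F x ≤ 1 := by
    rw [← h.hm.tsum_eq]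
    exact sm2.tsum_le_tsum (fun x => mul_le_of_le_one_right (h.mpos x).le (hF x).2) h.hm.summable
  rw [abs_le]; constructor <;> linarith

lemma Good.final (h : Good a b m) {ν : ℕ → ℝ} (hν : ∀ k, 0 ≤ ν k) (hs : HasSum ν 1)
    {δ : ℝ} (hδ : 0 < δ) : ∃ T : ℕ, ∀ t ≥ T, ∀ F : ℕ → ℝ, (∀ k, 0 ≤ F k ∧ F k ≤ 1) →
      |∑' k, ν k * (Q a b)^[t] F k - ∑' x, m x * F x| ≤ δ := by
  have h1 : Tendsto (fun t => ∑' k, ν k * min (D a b m k t) 1) atTop (𝓝 (∑' x : ℕ, (0:ℝ))) := by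
    refine tendsto_tsum_of_dominated_convergence (bound := ν) hs.summable ?_ ?_
    · intro k
      have := ((h.D_tendsto k).min (tendsto_const_nhds (x := (1:ℝ)))).const_mul (ν k)
      simpa using this
    · refine Eventually.of_forall fun t k => ?_
      have d0 : 0 ≤ D a b m k t := tsum_nonneg fun x => mul_nonneg (h.mpos x).le (abs_nonneg _)
      rw [Real.norm_eq_abs, abs_mul, abs_of_nonneg (hν k)]
      refine mul_le_of_le_one_right (hν k) ?_
      rw [abs_of_nonneg (le_min d0 zero_le_one)]
      exact min_le_right _ _
  rw [tsum_zero] at h1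
  obtain ⟨T, hT⟩ := eventually_atTop.1 (h1.eventually (gt_mem_nhds hδ))
  refine ⟨T, fun t ht F hF => le_trans ?_ (hT t ht).le⟩
  have sm : ∀ g : ℕ → ℝ, (∀ k, |g k| ≤ 1) → Summable fun k => ν k * g k := by
    intro g hg
    refine Summable.of_norm_bounded hs.summable fun k => ?_
    rw [Real.norm_eq_abs, abs_mul, abs_of_nonneg (hν k)]
    exact mul_le_of_le_one_right (hν k) (hg k)
  have e : ∑' k, ν k * (Q a b)^[t] F k - ∑' x, m x * F x =
      ∑' k, ν k * ((Q a b)^[t] F k - ∑' x, m x * F x) := by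
    simp_rw [mul_sub]
    rw [(sm _ fun k => abs_le_of_mem (h.iter_mem hF t k)).tsum_sub (hs.summable.mul_right _),
      tsum_mul_right, hs.tsum_eq, one_mul]
  rw [e]
  have hS : Summable fun k => ν k * min (D a b m k t) 1 := sm _ fun k => by
    have d0 : 0 ≤ D a b m k t := tsum_nonneg fun x => mul_nonneg (h.mpos x).le (abs_nonneg _)
    rw [abs_of_nonneg (le_min d0 zero_le_one)]
    exact min_le_right _ _
  have hle : ∀ k, ‖ν k * ((Q a b)^[t] F k - ∑' x, m x * F x)‖ ≤ ν k * min (D a b m k t) 1 := by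
    intro k
    rw [Real.norm_eq_abs, abs_mul, abs_of_nonneg (hν k)]
    exact mul_le_mul_of_nonneg_left (le_min (h.bound hF k t) (h.bound1 hF k t)) (hν k)
  exact tsum_of_norm_bounded hS.hasSum hle

/-! measure part -/

/-- shift -/
def θ : (ℕ → Outcome) → (ℕ → Outcome) := fun ω u => ω (u + 1)

lemma mem_cyl {w : List Outcome} {ω : ℕ → Outcome} :
    ω ∈ cylinder w ↔ ∀ i (hi : i < w.length), ω i = w[i] := by
  unfold _root_.cylinder
  exact ⟨fun h i hi => h ⟨i, hi⟩, fun h i => h i i.2⟩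

lemma mem_cyl_cons {w : List Outcome} {c : Outcome} {ω : ℕ → Outcome} :
    ω ∈ cylinder (c :: w) ↔ ω 0 = c ∧ θ ω ∈ cylinder w := by
  rw [mem_cyl, mem_cyl]
  constructor
  · intro h
    exact ⟨h 0 (by simp), fun i hi => h (i+1) (by simpa using hi)⟩
  · rintro ⟨h0, h1⟩ i hi
    cases i with
    | zero => simpa using h0
    | succ n => simpa [θ] using h1 n (by simpa using hi)

instance : Fintype Outcome :=
  ⟨{.mm, .mp, .pm, .pp}, by intro x; cases x <;> decide⟩

instance : DiscreteMeasurableSpace Outcome := ⟨fun _ => trivial⟩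

lemma meas_θ : Measurable θ := measurable_pi_lambda _ fun u => measurable_pi_apply (u+1)

lemma meas_cyl (w : List Outcome) : MeasurableSet (cylinder w) := by
  have : cylinder w = ⋂ i : Fin w.length, {ω | ω i = w.get i} := by
    ext ω; simp [_root_.cylinder]
  rw [this]
  refine MeasurableSet.iInter fun i => ?_
  exact (measurable_pi_apply (X := fun _ : ℕ => Outcome) (i : ℕ)) (MeasurableSet.singleton (w.get i))

lemma pi_cyl : IsPiSystem (Set.range cylinder) := by
  have key : ∀ w w' : List Outcome, w.length ≤ w'.length → (cylinder w ∩ cylinder w').Nonempty →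
      cylinder w ∩ cylinder w' = cylinder w' := by
    rintro w w' hl ⟨ω, h1, h2⟩
    refine Set.inter_eq_right.2 fun ω' h' => ?_
    rw [mem_cyl] at *
    intro i hi
    rw [h' i (by omega), ← h2 i (by omega), h1 i hi]
  rintro _ ⟨w, rfl⟩ _ ⟨w', rfl⟩ hne
  rcases le_total w.length w'.length with hl | hl
  · exact ⟨w', (key w w' hl hne).symm⟩
  · rw [Set.inter_comm] at hne ⊢
    exact ⟨w, (key w' w hl hne).symm⟩

lemma gen_cyl : (MeasurableSpace.pi : MeasurableSpace (ℕ → Outcome)) =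
    MeasurableSpace.generateFrom (Set.range cylinder) := by
  apply le_antisymm
  · refine iSup_le fun i => ?_
    rw [← measurable_iff_comap_le]
    refine @measurable_to_countable' _ _ _ _ (MeasurableSpace.generateFrom (Set.range cylinder)) _
      fun c => ?_
    have : (fun ω : ℕ → Outcome => ω i) ⁻¹' {c} =
        ⋃ w ∈ {w : List Outcome | w[i]? = some c}, cylinder w := by
      ext ω
      simp only [Set.mem_preimage, Set.mem_singleton_iff, Set.mem_iUnion, Set.mem_ofPred_eq,
        exists_prop]
      constructor
      · intro h
        refine ⟨List.ofFn (fun j : Fin (i+1) => ω j), ?_, ?_⟩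
        · simp [-List.ofFn_succ, h]
        · rw [mem_cyl]; intro j hj; simp [-List.ofFn_succ]
      · rintro ⟨w, h1, h2⟩
        obtain ⟨hi, e⟩ := List.getElem?_eq_some_iff.1 h1
        rw [mem_cyl] at h2
        rw [h2 i hi, e]
    rw [this]
    exact MeasurableSet.biUnion (Set.to_countable _)
      fun w _ => MeasurableSpace.measurableSet_generateFrom ⟨w, rfl⟩
  · refine MeasurableSpace.generateFrom_le ?_
    rintro _ ⟨w, rfl⟩
    exact meas_cyl w

end BD

theorem rabiAlpha_mem {ξ η : ℝ} (hξ : 0 < ξ) (hη : 0 ≤ η) (k : ℕ) :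
    0 ≤ rabiAlpha ξ η k ∧ rabiAlpha ξ η k ≤ 1 := by
  unfold rabiAlpha
  split_ifs with h
  · norm_num
  · have hk : (0:ℝ) < k := by exact_mod_cast Nat.pos_of_ne_zero h
    have hx : 0 < ξ * k := by positivity
    constructor
    · positivity
    · rw [div_le_one (by positivity)]
      have := Real.sin_sq_le_one (Real.pi * Real.sqrt (ξ * k + η))
      nlinarith

theorem rabiAlpha_pos {ξ η : ℝ} (hξ : 0 < ξ) (hη : 0 ≤ η) (hnr : NonResonant ξ η) (k : ℕ) :
    0 < rabiAlpha ξ η (k + 1) := by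
  unfold rabiAlpha
  rw [if_neg (by omega)]
  have hx : 0 < ξ * ((k + 1 : ℕ) : ℝ) := by positivity
  have : Real.sin (Real.pi * Real.sqrt (ξ * ((k + 1 : ℕ) : ℝ) + η)) ≠ 0 := by
    intro h0
    obtain ⟨n, hn⟩ := Real.sin_eq_zero_iff.1 h0
    have h1 : (n : ℝ) = Real.sqrt (ξ * ((k + 1 : ℕ) : ℝ) + η) := by
      have := Real.pi_pos
      rw [mul_comm] at hn
      exact mul_left_cancel₀ this.ne' hn
    refine hnr (k+1) ⟨by omega, n.natAbs, ?_⟩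
    have h2 : ((n.natAbs : ℕ) : ℝ)^2 = (n:ℝ)^2 := by
      rw [Nat.cast_natAbs]; push_cast; exact sq_abs _
    rw [h2, h1, Real.sq_sqrt (by positivity)]
  positivity

theorem good_rabi {ε β ξ η : ℝ} (hε : 0 < ε) (hβ : 0 < β) (hξ : 0 < ξ) (hη : 0 ≤ η)
    (hnr : NonResonant ξ η) :
    BD.Good (fun k => pMinus β ε * rabiAlpha ξ η k) (fun k => pPlus β ε * rabiAlpha ξ η (k + 1))
      (muGibbs β ε) := by
  have he := Real.exp_pos (-(β * ε))
  have he1 : Real.exp (-(β * ε)) < 1 := by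
    rw [Real.exp_lt_one_iff]; nlinarith [mul_pos hβ hε]
  have hm : 0 < pMinus β ε := by unfold pMinus; positivity
  have hp : 0 < pPlus β ε := by unfold pPlus; positivity
  have hs : pMinus β ε + pPlus β ε = 1 := by unfold pMinus pPlus; field_simp
  refine ⟨?_, ?_, ?_, ?_, ?_, ?_, ?_, ?_⟩
  · simp [rabiAlpha]
  · exact fun k => mul_pos hm (rabiAlpha_pos hξ hη hnr k)
  · exact fun k => mul_pos hp (rabiAlpha_pos hξ hη hnr k)
  · intro k
    nlinarith [(rabiAlpha_mem hξ hη k).2, (rabiAlpha_mem hξ hη (k+1)).2]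
  · show pPlus β ε * rabiAlpha ξ η (0 + 1) < 1
    nlinarith [(rabiAlpha_mem hξ hη (0+1)).2]
  · intro k
    unfold muGibbs
    exact mul_pos (by linarith) (Real.exp_pos _)
  · intro k
    have : Real.exp (-((k + 1 : ℕ) : ℝ) * (β * ε)) =
        Real.exp (-(k : ℝ) * (β * ε)) * Real.exp (-(β * ε)) := by
      rw [← Real.exp_add]; congr 1; push_cast; ring
    simp only [muGibbs, this, pMinus, pPlus]
    ring
  · have : muGibbs β ε = fun k : ℕ => (1 - Real.exp (-(β * ε))) * Real.exp (-(β * ε)) ^ k := by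
      funext k
      unfold muGibbs
      rw [← Real.exp_nat_mul]; congr 2; ring
    rw [this]
    have := (hasSum_geometric_of_lt_one he.le he1).mul_left (1 - Real.exp (-(β * ε)))
    rwa [mul_inv_cancel₀ (by linarith)] at this

theorem stepWeight_nonneg' {ε β ξ η : ℝ} (hξ : 0 < ξ) (hη : 0 ≤ η) (k : ℕ) (c : Outcome) :
    0 ≤ stepWeight β ε ξ η k c := by
  have hm : 0 < pMinus β ε := by unfold pMinus; positivity
  have hp : 0 < pPlus β ε := by unfold pPlus; positivity
  have h1 := rabiAlpha_mem hξ hη k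
  have h2 := rabiAlpha_mem hξ hη (k+1)
  cases c <;> simp only [stepWeight] <;> apply mul_nonneg <;> linarith

theorem markov_step {ε β ξ η : ℝ} (hξ : 0 < ξ) (hη : 0 ≤ η)
    (P : ℕ → MeasureTheory.Measure (ℕ → Outcome))
    (hP : ∀ k, MeasureTheory.IsProbabilityMeasure (P k))
    (hcyl : ∀ k (w : List Outcome),
      P k (cylinder w) = ENNReal.ofReal (wordWeight β ε ξ η k w)) (k : ℕ) :
    (P k).map BD.θ = ∑ c : Outcome,
      ENNReal.ofReal (stepWeight β ε ξ η k c) • P (stepSucc k c) := by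
  have hcy : ∀ w : List Outcome, (P k).map BD.θ (cylinder w) = (∑ c : Outcome,
      ENNReal.ofReal (stepWeight β ε ξ η k c) • P (stepSucc k c)) (cylinder w) := by
    intro w
    rw [Measure.map_apply BD.meas_θ (BD.meas_cyl w)]
    have : BD.θ ⁻¹' cylinder w = ⋃ c : Outcome, cylinder (c :: w) := by
      ext ω
      simp [BD.mem_cyl_cons]
    rw [this, measure_iUnion ?_ fun c => BD.meas_cyl _, tsum_fintype, Measure.finsetSum_apply]
    · refine Finset.sum_congr rfl fun c _ => ?_
      rw [Measure.smul_apply, smul_eq_mul, hcyl, hcyl, wordWeight,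
        ENNReal.ofReal_mul (stepWeight_nonneg' hξ hη k c)]
    · intro c d hcd
      refine Set.disjoint_left.2 fun ω h1 h2 => hcd ?_
      rw [BD.mem_cyl_cons] at h1 h2
      exact h1.1.symm.trans h2.1
  refine ext_of_generate_finite _ BD.gen_cyl BD.pi_cyl ?_ ?_
  · rintro _ ⟨w, rfl⟩
    exact hcy w
  · have : (Set.univ : Set (ℕ → Outcome)) = cylinder [] := by
      ext ω; simp [BD.mem_cyl]
    rw [this]
    exact hcy []

theorem markov_real {ε β ξ η : ℝ} (hξ : 0 < ξ) (hη : 0 ≤ η)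
    (P : ℕ → MeasureTheory.Measure (ℕ → Outcome))
    (hP : ∀ k, MeasureTheory.IsProbabilityMeasure (P k))
    (hcyl : ∀ k (w : List Outcome),
      P k (cylinder w) = ENNReal.ofReal (wordWeight β ε ξ η k w))
    {O : Set (ℕ → Outcome)} (hO : MeasurableSet O) (k : ℕ) :
    (P k (BD.θ ⁻¹' O)).toReal = BD.Q (fun k => pMinus β ε * rabiAlpha ξ η k)
      (fun k => pPlus β ε * rabiAlpha ξ η (k + 1)) (fun j => (P j O).toReal) k := by
  rw [← Measure.map_apply BD.meas_θ hO, markov_step hξ hη P hP hcyl, Measure.finsetSum_apply]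
  simp only [Measure.smul_apply, smul_eq_mul]
  rw [ENNReal.toReal_sum fun c _ => ENNReal.mul_ne_top ENNReal.ofReal_ne_top (measure_ne_top _ _)]
  simp only [ENNReal.toReal_mul, ENNReal.toReal_ofReal (stepWeight_nonneg' hξ hη k _)]
  have hu : (Finset.univ : Finset Outcome) = {.mm, .mp, .pm, .pp} := rfl
  rw [hu]
  have hs : pMinus β ε + pPlus β ε = 1 := by
    unfold pMinus pPlus
    have he := Real.exp_pos (-(β * ε))
    field_simp
  have hs' : pMinus β ε = 1 - pPlus β ε := by linarith
  simp only [Finset.mem_insert, Finset.mem_singleton, reduceCtorEq, or_self, not_false_eq_true,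
    Finset.sum_insert, Finset.sum_singleton, stepWeight, stepSucc, BD.Q]
  linear_combination (P k O).toReal * hs

theorem markov_iter {ε β ξ η : ℝ} (hξ : 0 < ξ) (hη : 0 ≤ η)
    (P : ℕ → MeasureTheory.Measure (ℕ → Outcome))
    (hP : ∀ k, MeasureTheory.IsProbabilityMeasure (P k))
    (hcyl : ∀ k (w : List Outcome),
      P k (cylinder w) = ENNReal.ofReal (wordWeight β ε ξ η k w))
    {O : Set (ℕ → Outcome)} (hO : MeasurableSet O) (t : ℕ) : 
    (fun k => (P k (BD.θ^[t] ⁻¹' O)).toReal) = (BD.Q (fun k => pMinus β ε * rabiAlpha ξ η k)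
      (fun k => pPlus β ε * rabiAlpha ξ η (k + 1)))^[t] (fun j => (P j O).toReal) := by
  induction t with
  | zero => rfl
  | succ n ih =>
    funext k
    rw [Function.iterate_succ, Set.preimage_comp, markov_real hξ hη P hP hcyl
      ((BD.meas_θ.iterate n) hO), ih, Function.iterate_succ_apply']

theorem sum_toReal (P : ℕ → MeasureTheory.Measure (ℕ → Outcome))
    (hP : ∀ k, MeasureTheory.IsProbabilityMeasure (P k)) {ν : ℕ → ℝ} (hν : ∀ k, 0 ≤ ν k)
    {O : Set (ℕ → Outcome)} (hO : MeasurableSet O) :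
    ((Measure.sum (fun k => ENNReal.ofReal (ν k) • P k)) O).toReal =
      ∑' k, ν k * (P k O).toReal := by
  rw [Measure.sum_apply _ hO]
  simp only [Measure.smul_apply, smul_eq_mul]
  rw [ENNReal.tsum_toReal_eq fun k => ENNReal.mul_ne_top ENNReal.ofReal_ne_top (measure_ne_top _ _)]
  refine tsum_congr fun k => ?_
  rw [ENNReal.toReal_mul, ENNReal.toReal_ofReal (hν k)]

/-- Theorem 2.5, Fock-diagonal initial states: under the non-resonant
condition and `β > 0`, for every probability distribution `ν` on `ℕ`, the shifted
measures `ℙ_ν ∘ θ^{−t}` converge in total variation to `ℙ_{μ_Gibbs}`. -/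
theorem statement11 (ε β ξ η : ℝ) (hε : 0 < ε) (hβ : 0 < β) (hξ : 0 < ξ) (hη : 0 ≤ η)
    (hnr : NonResonant ξ η)
    (P : ℕ → MeasureTheory.Measure (ℕ → Outcome))
    (hP : ∀ k, MeasureTheory.IsProbabilityMeasure (P k))
    (hcyl : ∀ k (w : List Outcome),
      P k (cylinder w) = ENNReal.ofReal (wordWeight β ε ξ η k w)) :
    ∀ ν : ℕ → ℝ, (∀ k, 0 ≤ ν k) → (∑' k : ℕ, ν k) = 1 →
      ∀ δ : ℝ, 0 < δ → ∃ T : ℕ, ∀ t ≥ T, ∀ O : Set (ℕ → Outcome), MeasurableSet O →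
        |((MeasureTheory.Measure.sum (fun k => ENNReal.ofReal (ν k) • P k))
            (((fun (ω : ℕ → Outcome) (u : ℕ) => ω (u + 1))^[t]) ⁻¹' O)).toReal -
          ((MeasureTheory.Measure.sum (fun k => ENNReal.ofReal (muGibbs β ε k) • P k))
            O).toReal| ≤ δ := by
  intro ν hν hsum δ hδ
  have hs : HasSum ν 1 := by
    have : Summable ν := by
      by_contra hn
      rw [tsum_eq_zero_of_not_summable hn] at hsum
      exact zero_ne_one hsum
    rw [← hsum]; exact this.hasSum
  have hG := good_rabi hε hβ hξ hη hnr
  obtain ⟨T, hT⟩ := hG.final hν hs hδ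
  refine ⟨T, fun t ht O hO => ?_⟩
  have hO' : MeasurableSet (BD.θ^[t] ⁻¹' O) := (BD.meas_θ.iterate t) hO
  have := hT t ht (fun j => (P j O).toReal) (fun k => ⟨ENNReal.toReal_nonneg, by
    have := ENNReal.toReal_mono ENNReal.one_ne_top (prob_le_one (μ := P k) (s := O))
    simpa using this⟩)
  rw [← markov_iter hξ hη P hP hcyl hO t] at this
  change |((Measure.sum (fun k => ENNReal.ofReal (ν k) • P k)) (BD.θ^[t] ⁻¹' O)).toReal - _| ≤ δ
  rw [sum_toReal P hP hν hO', sum_toReal P hP (fun k => (hG.mpos k).le) hO]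
  exact this
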